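/- Let X be a separable real Banach space. Then the following are equivalent: (a) RW(a, X) < 1 + a for all a > 0; (b) there exists a > 0 such that RW(a, X) < 1 + a; (c) RW(1, X) < 2. -/

import Mathlib

open Filter Topology

/-- The coefficient `RW(a, X)` of García-Falset, Llorens-Fuster and Mazcuñán-Navarro. -/
noncomputable def RWCoeff (X : Type*) [NormedAddCommGroup X] [NormedSpace ℝ X] (a : ℝ) : ℝ :=
  sSup {r : ℝ | ∃ (x : X) (xs : ℕ → X), ‖x‖ ≤ a ∧ (∀ n, ‖xs n‖ ≤ 1) ∧
    (∀ f : X →L[ℝ] ℝ, Filter.Tendsto (fun n => f (xs n)) Filter.atTop (nhds 0)) ∧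
    r = min (Filter.liminf (fun n => ‖xs n + x‖) Filter.atTop)
            (Filter.liminf (fun n => ‖xs n - x‖) Filter.atTop)}

/-- The values over which the supremum in `RWCoeff X a` is taken. -/
def rwValues (X : Type*) [NormedAddCommGroup X] [NormedSpace ℝ X] (a : ℝ) : Set ℝ :=
  {r : ℝ | ∃ (x : X) (xs : ℕ → X), ‖x‖ ≤ a ∧ (∀ n, ‖xs n‖ ≤ 1) ∧
    (∀ f : X →L[ℝ] ℝ, Filter.Tendsto (fun n => f (xs n)) Filter.atTop (nhds 0)) ∧
    r = min (Filter.liminf (fun n => ‖xs n + x‖) Filter.atTop)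
            (Filter.liminf (fun n => ‖xs n - x‖) Filter.atTop)}

lemma norm_add_le_one_add {X : Type*} [SeminormedAddCommGroup X] {u v : X} {a : ℝ}
    (hu : ‖u‖ ≤ 1) (hv : ‖v‖ ≤ a) :
    ‖u + v‖ ≤ 1 + a :=
  (norm_add_le _ _).trans (add_le_add hu hv)

lemma isCoboundedUnder_norm_add {X : Type*} [SeminormedAddCommGroup X] {xs : ℕ → X} {x : X}
    (hxs : ∀ n, ‖xs n‖ ≤ 1) :
    IsCoboundedUnder (· ≥ ·) atTop (fun n => ‖xs n + x‖) :=
  (isBoundedUnder_of ⟨1 + ‖x‖, fun n => norm_add_le_one_add (hxs n) le_rfl⟩ :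
    IsBoundedUnder (· ≤ ·) atTop _).isCoboundedUnder_ge

lemma isBoundedUnder_norm_add {X : Type*} [SeminormedAddCommGroup X] (xs : ℕ → X)
    (x : X) :
    IsBoundedUnder (· ≥ ·) atTop (fun n => ‖xs n + x‖) :=
  isBoundedUnder_of ⟨0, fun _ => norm_nonneg _⟩

lemma liminf_norm_add_le {X : Type*} [SeminormedAddCommGroup X] {xs : ℕ → X} {x : X} {a : ℝ}
    (hxs : ∀ n, ‖xs n‖ ≤ 1) (hx : ‖x‖ ≤ a) :
    liminf (fun n => ‖xs n + x‖) atTop ≤ 1 + a :=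
  liminf_le_of_le (isBoundedUnder_norm_add xs x) fun _ hc =>
    let ⟨n, hn⟩ := hc.exists
    hn.trans (norm_add_le_one_add (hxs n) hx)

section

variable {X : Type*} [NormedAddCommGroup X] [NormedSpace ℝ X]

lemma norm_add_smul_ge {u v : X} {a b : ℝ} (ha : 0 < a) (hb : 0 < b) (hu : ‖u‖ ≤ 1)
    (hv : ‖v‖ ≤ b) :
    1 + a - max 1 (a / b) * (1 + b - ‖u + v‖) ≤ ‖u + (a / b) • v‖ := by
  have hab : a / b * b = a := by field_simp
  have ht : 0 < a / b := by positivity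
  generalize a / b = t at *
  rcases le_total t 1 with h | h
  · rw [max_eq_left h]
    have h₁ : ‖u + v‖ ≤ ‖u + t • v‖ + ‖(1 - t) • v‖ := by
      refine le_trans (le_of_eq ?_) (norm_add_le _ _)
      congr 1
      module
    rw [norm_smul, Real.norm_of_nonneg (by linarith)] at h₁
    nlinarith [mul_le_mul_of_nonneg_left hv (sub_nonneg.2 h)]
  · rw [max_eq_right h]
    have h₁ : ‖t • (u + v)‖ ≤ ‖u + t • v‖ + ‖(t - 1) • u‖ := by
      refine le_trans (le_of_eq ?_) (norm_add_le _ _)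
      congr 1
      module
    rw [norm_smul, norm_smul, Real.norm_of_nonneg ht.le, Real.norm_of_nonneg (by linarith)] at h₁
    nlinarith [mul_le_mul_of_nonneg_left hu (sub_nonneg.2 h)]

lemma liminf_norm_add_smul_ge {xs : ℕ → X} {x : X} {a b : ℝ} (ha : 0 < a) (hb : 0 < b)
    (hxs : ∀ n, ‖xs n‖ ≤ 1) (hx : ‖x‖ ≤ b) :
    1 + a - max 1 (a / b) * (1 + b - liminf (fun n => ‖xs n + x‖) atTop) ≤
      liminf (fun n => ‖xs n + (a / b) • x‖) atTop := by
  have hK : 0 < max 1 (a / b) := lt_max_of_lt_left one_pos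
  refine le_of_forall_pos_le_add fun ε hε => ?_
  have h := eventually_lt_of_lt_liminf
    (sub_lt_self (liminf (fun n => ‖xs n + x‖) atTop) (div_pos hε hK))
    (isBoundedUnder_norm_add xs x)
  rw [← sub_le_iff_le_add]
  refine le_liminf_of_le (isCoboundedUnder_norm_add hxs) (h.mono fun n hn => ?_)
  refine le_trans ?_ (norm_add_smul_ge ha hb (hxs n) hx)
  have h₁ := mul_le_mul_of_nonneg_left hn.le hK.le
  rw [mul_sub, mul_div_cancel₀ _ hK.ne'] at h₁
  linarith

lemma rwValues_nonempty {a : ℝ} (ha : 0 < a) : (rwValues X a).Nonempty :=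
  ⟨_, 0, fun _ => 0, by simpa using ha.le, by simp, by simp, rfl⟩

lemma bddAbove_rwValues (a : ℝ) : BddAbove (rwValues X a) := by
  refine ⟨1 + a, ?_⟩
  rintro _ ⟨x, xs, hx, hxs, -, rfl⟩
  exact (min_le_left _ _).trans (liminf_norm_add_le hxs hx)

lemma exists_rwValues_ge {a b r : ℝ} (ha : 0 < a) (hb : 0 < b) (hr : r ∈ rwValues X b) :
    ∃ s ∈ rwValues X a, 1 + a - max 1 (a / b) * (1 + b - r) ≤ s := by
  obtain ⟨x, xs, hx, hxs, hweak, rfl⟩ := hr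
  have hK : 0 ≤ max 1 (a / b) := zero_le_one.trans (le_max_left _ _)
  refine ⟨_, ⟨(a / b) • x, xs, ?_, hxs, hweak, rfl⟩, le_min ?_ ?_⟩
  · rw [norm_smul, Real.norm_of_nonneg (by positivity)]
    calc a / b * ‖x‖ ≤ a / b * b := by gcongr
      _ = a := by field_simp
  · refine le_trans ?_ (liminf_norm_add_smul_ge ha hb hxs hx)
    gcongr
    exact min_le_left _ _
  · have h := liminf_norm_add_smul_ge ha hb hxs ((norm_neg x).trans_le hx)
    simp only [smul_neg, ← sub_eq_add_neg] at h
    refine le_trans ?_ h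
    gcongr
    exact min_le_right _ _

lemma RWCoeff_lt_one_add {a b : ℝ} (ha : 0 < a) (hb : 0 < b) (h : RWCoeff X a < 1 + a) :
    RWCoeff X b < 1 + b := by
  have hK : 0 < max 1 (a / b) := lt_max_of_lt_left one_pos
  have hle : RWCoeff X b ≤ 1 + b - (1 + a - RWCoeff X a) / max 1 (a / b) := by
    refine csSup_le (rwValues_nonempty hb) fun r hr => ?_
    obtain ⟨s, hs, hrs⟩ := exists_rwValues_ge ha hb hr
    have hsa : s ≤ RWCoeff X a := le_csSup (bddAbove_rwValues a) hs
    rw [le_sub_comm, div_le_iff₀' hK]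
    linarith
  exact hle.trans_lt (sub_lt_self _ (div_pos (sub_pos.2 h) hK))

end

theorem stmt5 (X : Type*) [NormedAddCommGroup X] [NormedSpace ℝ X] [CompleteSpace X]
    [TopologicalSpace.SeparableSpace X] :
    ((∀ a : ℝ, 0 < a → RWCoeff X a < 1 + a) ↔ (∃ a : ℝ, 0 < a ∧ RWCoeff X a < 1 + a)) ∧
    ((∀ a : ℝ, 0 < a → RWCoeff X a < 1 + a) ↔ RWCoeff X 1 < 2) := by
  refine ⟨⟨fun h => ⟨1, one_pos, h 1 one_pos⟩,
      fun ⟨a, ha, h⟩ b hb => RWCoeff_lt_one_add ha hb h⟩,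
    fun h => (h 1 one_pos).trans_eq one_add_one_eq_two,
    fun h b hb => RWCoeff_lt_one_add one_pos hb (h.trans_eq one_add_one_eq_two.symm)⟩
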